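/- For all natural numbers n ≥ 1 and k ≥ 1, the numbers T(n,k) of B_n type set partitions with exactly k block pairs satisfy the recurrence T(n,k) = (2k+1)·T(n−1,k) + T(n−1,k−1), and T(n,0) = 1 for all n ≥ 0. -/

import Mathlib

open Finset

attribute [local instance] Classical.propDecidable

/-- The negation `−β` of a block `β ⊆ ℤ`. -/
def negBlock (β : Finset ℤ) : Finset ℤ := β.image (fun x => -x)

/-- `π` is a `Bₙ`-type set partition of `{−n, …, n}`: blocks come in pairs `β, −β`, and exactly
one block (the zero block) is symmetric. -/
def IsBType {n : ℕ} (π : Finpartition (Finset.Icc (-(n : ℤ)) (n : ℤ))) : Prop :=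
  (∀ β ∈ π.parts, negBlock β ∈ π.parts) ∧
  (π.parts.filter (fun β => negBlock β = β)).card = 1

/-- `T n k`: the number of `Bₙ`-type set partitions with exactly `k` block pairs
(i.e. with `2k+1` blocks in total). -/
noncomputable def Tb (n k : ℕ) : ℕ :=
  (univ.filter (fun π : Finpartition (Finset.Icc (-(n : ℤ)) (n : ℤ)) =>
    IsBType π ∧ π.parts.card = 2 * k + 1)).card

theorem mem_negBlock {β : Finset ℤ} {x : ℤ} : x ∈ negBlock β ↔ -x ∈ β := by
  unfold negBlock
  rw [Finset.mem_image]
  constructor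
  · rintro ⟨y, hy, rfl⟩
    simpa using hy
  · intro h
    exact ⟨-x, h, by simp⟩

theorem negBlock_negBlock (β : Finset ℤ) : negBlock (negBlock β) = β := by
  ext x
  simp [mem_negBlock]

/-- Element-wise description of the families of blocks of type B partitions. -/
structure Good (n : ℕ) (S : Finset (Finset ℤ)) : Prop where
  ne : ∀ β ∈ S, ∃ x, x ∈ β
  bd : ∀ β ∈ S, ∀ x ∈ β, -(n : ℤ) ≤ x ∧ x ≤ n
  ex : ∀ x : ℤ, -(n : ℤ) ≤ x → x ≤ n → ∃ β ∈ S, x ∈ β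
  un : ∀ β ∈ S, ∀ γ ∈ S, ∀ x, x ∈ β → x ∈ γ → β = γ
  ng : ∀ β ∈ S, negBlock β ∈ S
  ze : ∀ β ∈ S, ∀ x, x ∈ β → -x ∈ β → (0 : ℤ) ∈ β

noncomputable def goodFam (n k : ℕ) : Finset (Finset (Finset ℤ)) :=
  ((Finset.Icc (-(n : ℤ)) (n : ℤ)).powerset.powerset).filter
    (fun S => Good n S ∧ S.card = 2 * k + 1)

theorem mem_goodFam {n k : ℕ} {S : Finset (Finset ℤ)} :
    S ∈ goodFam n k ↔ Good n S ∧ S.card = 2 * k + 1 := by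
  unfold goodFam
  rw [Finset.mem_filter]
  constructor
  · exact fun h => h.2
  · intro h
    refine ⟨?_, h⟩
    rw [Finset.mem_powerset]
    intro β hβ
    rw [Finset.mem_powerset]
    intro x hx
    rw [Finset.mem_Icc]
    exact h.1.bd β hβ x hx

theorem good_of_isBType {n : ℕ} (π : Finpartition (Finset.Icc (-(n : ℤ)) (n : ℤ)))
    (h : IsBType π) : Good n π.parts := by
  obtain ⟨h1, h2⟩ := h
  have un : ∀ β ∈ π.parts, ∀ γ ∈ π.parts, ∀ x, x ∈ β → x ∈ γ → β = γ :=
    fun β hβ γ hγ x hx hx' => π.eq_of_mem_parts hβ hγ hx hx'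
  refine ⟨fun β hβ => π.nonempty_of_mem_parts hβ, ?_, ?_, un, h1, ?_⟩
  · intro β hβ x hx
    exact Finset.mem_Icc.1 (π.le hβ hx)
  · intro x hx hx'
    exact π.exists_mem (Finset.mem_Icc.2 ⟨hx, hx'⟩)
  · intro β hβ x hx hx'
    obtain ⟨δ, hδ⟩ := Finset.card_eq_one.1 h2
    have key : ∀ γ ∈ π.parts, ∀ y, y ∈ γ → -y ∈ γ → γ = δ := by
      intro γ hγ y hy hy'
      have : γ ∈ π.parts.filter (fun β => negBlock β = β) := by
        rw [Finset.mem_filter]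
        exact ⟨hγ, un _ (h1 γ hγ) _ hγ y (mem_negBlock.2 hy') hy⟩
      rw [hδ] at this
      exact Finset.mem_singleton.1 this
    obtain ⟨ζ, hζ, h0⟩ := π.exists_mem (a := (0 : ℤ)) (Finset.mem_Icc.2 ⟨by simp, by simp⟩)
    rw [key β hβ x hx hx', ← key ζ hζ 0 h0 (by simpa using h0)]
    exact h0

theorem isBType_of_good {n : ℕ} (π : Finpartition (Finset.Icc (-(n : ℤ)) (n : ℤ)))
    (h : Good n π.parts) : IsBType π := by
  refine ⟨h.ng, ?_⟩
  obtain ⟨ζ, hζ, h0⟩ := h.ex 0 (by simp) (by simp)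
  rw [Finset.card_eq_one]
  refine ⟨ζ, ?_⟩
  ext β
  rw [Finset.mem_filter, Finset.mem_singleton]
  constructor
  · rintro ⟨hβ, hs⟩
    obtain ⟨x, hx⟩ := h.ne β hβ
    have hx' : -x ∈ β := by
      rw [← mem_negBlock, hs]; exact hx
    exact h.un β hβ ζ hζ 0 (h.ze β hβ x hx hx') h0
  · rintro rfl
    exact ⟨hζ, h.un _ (h.ng _ hζ) _ hζ 0 (mem_negBlock.2 (by simpa using h0)) h0⟩

theorem Tb_eq (n k : ℕ) : Tb n k = (goodFam n k).card := by
  unfold Tb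
  refine Finset.card_bij (fun π _ => π.parts) ?_ ?_ ?_
  · intro π hπ
    rw [Finset.mem_filter] at hπ
    exact mem_goodFam.2 ⟨good_of_isBType π hπ.2.1, hπ.2.2⟩
  · intro π _ ρ _ h
    exact Finpartition.ext h
  · intro S hS
    obtain ⟨hg, hc⟩ := mem_goodFam.1 hS
    let π : Finpartition (Finset.Icc (-(n : ℤ)) (n : ℤ)) :=
      Finpartition.ofExistsUnique S
        (fun β hβ x hx => Finset.mem_Icc.2 (hg.bd β hβ x hx))
        (fun x hx => by
          obtain ⟨β, hβ, hxβ⟩ := hg.ex x (Finset.mem_Icc.1 hx).1 (Finset.mem_Icc.1 hx).2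
          exact ⟨β, ⟨hβ, hxβ⟩, fun γ hγ => hg.un _ hγ.1 _ hβ x hγ.2 hxβ⟩)
        (fun h => by
          obtain ⟨x, hx⟩ := hg.ne _ h
          simp at hx)
    have hp : π.parts = S := rfl
    refine ⟨π, ?_, hp⟩
    rw [Finset.mem_filter]
    exact ⟨Finset.mem_univ _, isBType_of_good π (hp ▸ hg), hp ▸ hc⟩

theorem goodFam_zero (n : ℕ) : (goodFam n 0).card = 1 := by
  rw [Finset.card_eq_one]
  refine ⟨{Finset.Icc (-(n : ℤ)) (n : ℤ)}, ?_⟩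
  ext S
  rw [mem_goodFam, Finset.mem_singleton]
  constructor
  · rintro ⟨hg, hc⟩
    obtain ⟨γ, rfl⟩ := Finset.card_eq_one.1 hc
    congr 1
    ext x
    rw [Finset.mem_Icc]
    constructor
    · exact hg.bd γ (by simp) x
    · rintro ⟨h1, h2⟩
      obtain ⟨β, hβ, hx⟩ := hg.ex x h1 h2
      rw [Finset.mem_singleton] at hβ
      exact hβ ▸ hx
  · rintro rfl
    refine ⟨⟨?_, ?_, ?_, ?_, ?_, ?_⟩, by simp⟩
    · intro β hβ
      rw [Finset.mem_singleton] at hβ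
      exact ⟨0, by simp [hβ]⟩
    · intro β hβ x hx
      rw [Finset.mem_singleton] at hβ
      subst hβ
      exact Finset.mem_Icc.1 hx
    · intro x h1 h2
      exact ⟨_, Finset.mem_singleton_self _, Finset.mem_Icc.2 ⟨h1, h2⟩⟩
    · intro β hβ γ hγ x _ _
      rw [Finset.mem_singleton] at hβ hγ
      rw [hβ, hγ]
    · intro β hβ
      rw [Finset.mem_singleton] at hβ ⊢
      subst hβ
      ext x
      rw [mem_negBlock, Finset.mem_Icc, Finset.mem_Icc]
      omega
    · intro β hβ x _ _
      rw [Finset.mem_singleton] at hβ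
      simp [hβ]

/-! ### Adding the pair of singletons -/

noncomputable def newFam (n : ℕ) (S : Finset (Finset ℤ)) : Finset (Finset ℤ) :=
  insert {(n : ℤ) + 1} (insert {-((n : ℤ) + 1)} S)

theorem mem_newFam {n : ℕ} {S : Finset (Finset ℤ)} {γ : Finset ℤ} :
    γ ∈ newFam n S ↔ γ = {(n : ℤ) + 1} ∨ γ = {-((n : ℤ) + 1)} ∨ γ ∈ S := by
  simp [newFam]

theorem negBlock_singleton (a : ℤ) : negBlock {a} = {-a} := by
  simp [negBlock]

theorem Good.top_notMem {n : ℕ} {S : Finset (Finset ℤ)} (h : Good n S) {γ : Finset ℤ}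
    (hγ : γ ∈ S) : (n : ℤ) + 1 ∉ γ := fun hx => by
  have := h.bd γ hγ _ hx
  omega

theorem Good.bot_notMem {n : ℕ} {S : Finset (Finset ℤ)} (h : Good n S) {γ : Finset ℤ}
    (hγ : γ ∈ S) : -((n : ℤ) + 1) ∉ γ := fun hx => by
  have := h.bd γ hγ _ hx
  omega

theorem Good.newFam {n : ℕ} {S : Finset (Finset ℤ)} (h : Good n S) :
    Good (n + 1) (newFam n S) := by
  refine ⟨?_, ?_, ?_, ?_, ?_, ?_⟩
  · intro β hβ
    rcases mem_newFam.1 hβ with rfl | rfl | hβ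
    · exact ⟨_, Finset.mem_singleton_self _⟩
    · exact ⟨_, Finset.mem_singleton_self _⟩
    · exact h.ne β hβ
  · intro β hβ x hx
    push_cast
    rcases mem_newFam.1 hβ with rfl | rfl | hβ
    · rw [Finset.mem_singleton] at hx; omega
    · rw [Finset.mem_singleton] at hx; omega
    · have := h.bd β hβ x hx
      omega
  · intro x h1 h2
    push_cast at h1 h2
    by_cases e1 : x = (n : ℤ) + 1
    · exact ⟨_, mem_newFam.2 (Or.inl rfl), by simp [e1]⟩
    by_cases e2 : x = -((n : ℤ) + 1)
    · exact ⟨_, mem_newFam.2 (Or.inr (Or.inl rfl)), by simp [e2]⟩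
    obtain ⟨β, hβ, hx⟩ := h.ex x (by omega) (by omega)
    exact ⟨β, mem_newFam.2 (Or.inr (Or.inr hβ)), hx⟩
  · intro β hβ γ hγ x hx hx'
    rcases mem_newFam.1 hβ with rfl | rfl | hβ <;> rcases mem_newFam.1 hγ with rfl | rfl | hγ
    · rfl
    · rw [Finset.mem_singleton] at hx hx'; omega
    · rw [Finset.mem_singleton] at hx; subst hx; exact absurd hx' (h.top_notMem hγ)
    · rw [Finset.mem_singleton] at hx hx'; omega
    · rfl
    · rw [Finset.mem_singleton] at hx; subst hx; exact absurd hx' (h.bot_notMem hγ)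
    · rw [Finset.mem_singleton] at hx'; subst hx'; exact absurd hx (h.top_notMem hβ)
    · rw [Finset.mem_singleton] at hx'; subst hx'; exact absurd hx (h.bot_notMem hβ)
    · exact h.un β hβ γ hγ x hx hx'
  · intro β hβ
    rw [mem_newFam]
    rcases mem_newFam.1 hβ with rfl | rfl | hβ
    · right; left; exact negBlock_singleton _
    · left; rw [negBlock_singleton, neg_neg]
    · right; right; exact h.ng β hβ
  · intro β hβ x hx hx'
    rcases mem_newFam.1 hβ with rfl | rfl | hβ
    · rw [Finset.mem_singleton] at hx hx'; omega
    · rw [Finset.mem_singleton] at hx hx'; omega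
    · exact h.ze β hβ x hx hx'

theorem Good.top_single {n : ℕ} {S : Finset (Finset ℤ)} (h : Good n S) :
    ({(n : ℤ) + 1} : Finset ℤ) ∉ S :=
  fun hh => h.top_notMem hh (Finset.mem_singleton_self _)

theorem Good.bot_single {n : ℕ} {S : Finset (Finset ℤ)} (h : Good n S) :
    ({-((n : ℤ) + 1)} : Finset ℤ) ∉ S :=
  fun hh => h.bot_notMem hh (Finset.mem_singleton_self _)

theorem topSing_ne_botSing (n : ℕ) : ({(n : ℤ) + 1} : Finset ℤ) ≠ {-((n : ℤ) + 1)} := by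
  intro h
  have := Finset.singleton_injective h
  omega

theorem Good.card_newFam {n : ℕ} {S : Finset (Finset ℤ)} (h : Good n S) :
    (_root_.newFam n S).card = S.card + 2 := by
  unfold _root_.newFam
  rw [Finset.card_insert_of_notMem, Finset.card_insert_of_notMem h.bot_single]
  rw [Finset.mem_insert]
  rintro (e | e)
  · exact topSing_ne_botSing n e
  · exact h.top_single e

theorem card_single (n k : ℕ) :
    ((goodFam (n + 1) (k + 1)).filter (fun T => ({(n : ℤ) + 1} : Finset ℤ) ∈ T)).card
      = (goodFam n k).card := by
  symm
  refine Finset.card_bij (fun S _ => newFam n S) ?_ ?_ ?_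
  · intro S hS
    obtain ⟨hg, hc⟩ := mem_goodFam.1 hS
    rw [Finset.mem_filter, mem_goodFam, hg.card_newFam]
    exact ⟨⟨hg.newFam, by omega⟩, mem_newFam.2 (Or.inl rfl)⟩
  · intro S hS S' hS' e
    obtain ⟨hg, -⟩ := mem_goodFam.1 hS
    obtain ⟨hg', -⟩ := mem_goodFam.1 hS'
    have key : ∀ S S', Good n S → newFam n S = newFam n S' → S ⊆ S' := by
      intro S S' hg e γ hγ
      have h1 : γ ∈ newFam n S' := e ▸ mem_newFam.2 (Or.inr (Or.inr hγ))
      rcases mem_newFam.1 h1 with rfl | rfl | h1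
      · exact absurd hγ hg.top_single
      · exact absurd hγ hg.bot_single
      · exact h1
    exact Finset.Subset.antisymm (key _ _ hg e) (key _ _ hg' e.symm)
  · intro T hT
    rw [Finset.mem_filter] at hT
    obtain ⟨hT, htop⟩ := hT
    obtain ⟨hg, hc⟩ := mem_goodFam.1 hT
    have hbot : ({-((n : ℤ) + 1)} : Finset ℤ) ∈ T := by
      rw [← negBlock_singleton]; exact hg.ng _ htop
    set S := (T.erase {(n : ℤ) + 1}).erase {-((n : ℤ) + 1)} with hS
    have hmem : ∀ γ, γ ∈ S ↔ γ ≠ {-((n : ℤ) + 1)} ∧ γ ≠ {(n : ℤ) + 1} ∧ γ ∈ T := by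
      intro γ
      rw [hS, Finset.mem_erase, Finset.mem_erase]
    have e : newFam n S = T := by
      ext γ
      rw [mem_newFam, hmem]
      constructor
      · rintro (rfl | rfl | h)
        · exact htop
        · exact hbot
        · exact h.2.2
      · tauto
    have gS : Good n S := by
      refine ⟨?_, ?_, ?_, ?_, ?_, ?_⟩
      · intro β hβ
        exact hg.ne β ((hmem β).1 hβ).2.2
      · intro β hβ x hx
        obtain ⟨h1, h2, h3⟩ := (hmem β).1 hβ
        have hb := hg.bd β h3 x hx
        push_cast at hb
        have n1 : x ≠ (n : ℤ) + 1 := by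
          rintro rfl
          exact h2 (hg.un _ h3 _ htop _ hx (Finset.mem_singleton_self _))
        have n2 : x ≠ -((n : ℤ) + 1) := by
          rintro rfl
          exact h1 (hg.un _ h3 _ hbot _ hx (Finset.mem_singleton_self _))
        omega
      · intro x h1 h2
        obtain ⟨β, hβ, hx⟩ := hg.ex x (by push_cast; omega) (by push_cast; omega)
        refine ⟨β, (hmem β).2 ⟨?_, ?_, hβ⟩, hx⟩
        · rintro rfl
          rw [Finset.mem_singleton] at hx; omega
        · rintro rfl
          rw [Finset.mem_singleton] at hx; omega
      · intro β hβ γ hγ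
        exact hg.un β ((hmem β).1 hβ).2.2 γ ((hmem γ).1 hγ).2.2
      · intro β hβ
        obtain ⟨h1, h2, h3⟩ := (hmem β).1 hβ
        refine (hmem _).2 ⟨?_, ?_, hg.ng β h3⟩
        · intro e
          apply h2
          rw [← negBlock_negBlock β, e, negBlock_singleton, neg_neg]
        · intro e
          apply h1
          rw [← negBlock_negBlock β, e, negBlock_singleton]
      · intro β hβ
        exact hg.ze β ((hmem β).1 hβ).2.2
    refine ⟨S, mem_goodFam.2 ⟨gS, ?_⟩, e⟩
    have := gS.card_newFam
    rw [e] at this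
    omega

/-! ### Adding the new pair to existing blocks -/

noncomputable def grow (n : ℕ) (β γ : Finset ℤ) : Finset ℤ :=
  γ ∪ ((if γ = β then {(n : ℤ) + 1} else ∅) ∪ (if γ = negBlock β then {-((n : ℤ) + 1)} else ∅))

theorem mem_grow {n : ℕ} {β γ : Finset ℤ} {x : ℤ} :
    x ∈ grow n β γ ↔ x ∈ γ ∨ (x = (n : ℤ) + 1 ∧ γ = β) ∨
      (x = -((n : ℤ) + 1) ∧ γ = negBlock β) := by
  unfold grow
  rw [Finset.mem_union, Finset.mem_union]
  split_ifs <;> simp_all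

noncomputable def cut (n : ℕ) (γ : Finset ℤ) : Finset ℤ :=
  γ.filter (fun x => -(n : ℤ) ≤ x ∧ x ≤ n)

theorem mem_cut {n : ℕ} {γ : Finset ℤ} {x : ℤ} :
    x ∈ cut n γ ↔ x ∈ γ ∧ -(n : ℤ) ≤ x ∧ x ≤ n := by
  unfold cut
  rw [Finset.mem_filter]

theorem cut_negBlock (n : ℕ) (γ : Finset ℤ) : cut n (negBlock γ) = negBlock (cut n γ) := by
  ext x
  rw [mem_cut, mem_negBlock, mem_negBlock, mem_cut]
  constructor <;> rintro ⟨h, h1, h2⟩ <;> exact ⟨h, by omega, by omega⟩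

theorem negBlock_eq_iff {β γ : Finset ℤ} : negBlock β = γ ↔ β = negBlock γ := by
  constructor
  · rintro rfl; rw [negBlock_negBlock]
  · rintro rfl; rw [negBlock_negBlock]

theorem grow_negBlock (n : ℕ) (β γ : Finset ℤ) :
    grow n β (negBlock γ) = negBlock (grow n β γ) := by
  ext x
  rw [mem_grow, mem_negBlock, mem_negBlock, mem_grow, negBlock_eq_iff, negBlock_eq_iff,
    negBlock_negBlock, neg_inj, neg_eq_iff_eq_neg]
  tauto

theorem Good.cut_grow {n : ℕ} {S : Finset (Finset ℤ)} (h : Good n S) (β : Finset ℤ)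
    {γ : Finset ℤ} (hγ : γ ∈ S) : cut n (grow n β γ) = γ := by
  ext x
  rw [mem_cut, mem_grow]
  constructor
  · rintro ⟨h1 | h1 | h1, h2⟩
    · exact h1
    · omega
    · omega
  · intro hx
    exact ⟨Or.inl hx, h.bd γ hγ x hx⟩

theorem Good.top_mem_grow {n : ℕ} {S : Finset (Finset ℤ)} (h : Good n S) (β : Finset ℤ)
    {γ : Finset ℤ} (hγ : γ ∈ S) : (n : ℤ) + 1 ∈ grow n β γ ↔ γ = β := by
  rw [mem_grow]
  have := h.top_notMem hγ
  constructor
  · rintro (h1 | h1 | h1)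
    · exact absurd h1 this
    · exact h1.2
    · omega
  · intro e
    exact Or.inr (Or.inl ⟨rfl, e⟩)

theorem Good.bot_mem_grow {n : ℕ} {S : Finset (Finset ℤ)} (h : Good n S) (β : Finset ℤ)
    {γ : Finset ℤ} (hγ : γ ∈ S) : -((n : ℤ) + 1) ∈ grow n β γ ↔ γ = negBlock β := by
  rw [mem_grow]
  have := h.bot_notMem hγ
  constructor
  · rintro (h1 | h1 | h1)
    · exact absurd h1 this
    · omega
    · exact h1.2
  · intro e
    exact Or.inr (Or.inr ⟨rfl, e⟩)

theorem Good.grow {n : ℕ} {S : Finset (Finset ℤ)} (h : Good n S) {β : Finset ℤ} (hβ : β ∈ S) :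
    Good (n + 1) (S.image (grow n β)) := by
  have old : ∀ γ ∈ S, ∀ x, x ≠ (n : ℤ) + 1 → x ≠ -((n : ℤ) + 1) →
      (x ∈ _root_.grow n β γ ↔ x ∈ γ) := by
    intro γ hγ x h1 h2
    rw [mem_grow]
    tauto
  refine ⟨?_, ?_, ?_, ?_, ?_, ?_⟩
  · intro γ hγ
    replace hγ := Finset.mem_image.1 hγ; obtain ⟨γ, hγ, rfl⟩ := hγ
    obtain ⟨x, hx⟩ := h.ne γ hγ
    exact ⟨x, mem_grow.2 (Or.inl hx)⟩
  · intro γ hγ x hx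
    replace hγ := Finset.mem_image.1 hγ; obtain ⟨γ, hγ, rfl⟩ := hγ
    push_cast
    rcases mem_grow.1 hx with h1 | h1 | h1
    · have := h.bd γ hγ x h1
      omega
    · omega
    · omega
  · intro x h1 h2
    push_cast at h1 h2
    by_cases e1 : x = (n : ℤ) + 1
    · exact ⟨_, Finset.mem_image_of_mem _ hβ, by rw [e1, h.top_mem_grow β hβ]⟩
    by_cases e2 : x = -((n : ℤ) + 1)
    · exact ⟨_, Finset.mem_image_of_mem _ (h.ng β hβ), by rw [e2, h.bot_mem_grow β (h.ng β hβ)]⟩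
    obtain ⟨γ, hγ, hx⟩ := h.ex x (by omega) (by omega)
    exact ⟨_, Finset.mem_image_of_mem _ hγ, mem_grow.2 (Or.inl hx)⟩
  · intro γ hγ δ hδ x hx hx'
    replace hγ := Finset.mem_image.1 hγ; obtain ⟨γ, hγ, rfl⟩ := hγ
    replace hδ := Finset.mem_image.1 hδ; obtain ⟨δ, hδ, rfl⟩ := hδ
    congr 1
    by_cases e1 : x = (n : ℤ) + 1
    · subst e1
      rw [(h.top_mem_grow β hγ).1 hx, (h.top_mem_grow β hδ).1 hx']
    by_cases e2 : x = -((n : ℤ) + 1)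
    · subst e2
      rw [(h.bot_mem_grow β hγ).1 hx, (h.bot_mem_grow β hδ).1 hx']
    exact h.un γ hγ δ hδ x ((old γ hγ x e1 e2).1 hx) ((old δ hδ x e1 e2).1 hx')
  · intro γ hγ
    replace hγ := Finset.mem_image.1 hγ; obtain ⟨γ, hγ, rfl⟩ := hγ
    rw [← grow_negBlock]
    exact Finset.mem_image_of_mem _ (h.ng γ hγ)
  · intro γ hγ x hx hx'
    replace hγ := Finset.mem_image.1 hγ; obtain ⟨γ, hγ, rfl⟩ := hγ
    refine mem_grow.2 (Or.inl ?_)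
    have sym : γ = β → γ = negBlock β → (0 : ℤ) ∈ γ := by
      intro e e'
      obtain ⟨y, hy⟩ := h.ne γ hγ
      refine h.ze γ hγ y hy ?_
      rw [e, ← mem_negBlock, ← e']
      exact hy
    by_cases e1 : x = (n : ℤ) + 1
    · subst e1
      exact sym ((h.top_mem_grow β hγ).1 hx) ((h.bot_mem_grow β hγ).1 hx')
    by_cases e2 : x = -((n : ℤ) + 1)
    · subst e2
      rw [neg_neg] at hx'
      exact sym ((h.top_mem_grow β hγ).1 hx') ((h.bot_mem_grow β hγ).1 hx)
    exact h.ze γ hγ x ((old γ hγ x e1 e2).1 hx) ((old γ hγ (-x) (by omega) (by omega)).1 hx')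

theorem Good.image_cut_grow {n : ℕ} {S : Finset (Finset ℤ)} (h : Good n S) (β : Finset ℤ) :
    (S.image (_root_.grow n β)).image (cut n) = S := by
  ext γ
  rw [Finset.mem_image]
  constructor
  · rintro ⟨δ, hδ, rfl⟩
    replace hδ := Finset.mem_image.1 hδ; obtain ⟨δ, hδ, rfl⟩ := hδ
    rw [h.cut_grow β hδ]
    exact hδ
  · intro hγ
    exact ⟨_, Finset.mem_image_of_mem _ hγ, h.cut_grow β hγ⟩

theorem Good.card_grow {n : ℕ} {S : Finset (Finset ℤ)} (h : Good n S) (β : Finset ℤ) :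
    (S.image (_root_.grow n β)).card = S.card := by
  refine Finset.card_image_of_injOn ?_
  intro γ hγ δ hδ e
  rw [← h.cut_grow β hγ, ← h.cut_grow β hδ]
  exact congrArg _ e

theorem exists_grow {n : ℕ} {T : Finset (Finset ℤ)} (h : Good (n + 1) T)
    (ht : ({(n : ℤ) + 1} : Finset ℤ) ∉ T) :
    ∃ S, Good n S ∧ ∃ β ∈ S, S.image (grow n β) = T := by
  obtain ⟨B, hB, hBt⟩ := h.ex ((n : ℤ) + 1) (by push_cast; omega) (by push_cast; omega)
  have bd : ∀ γ ∈ T, ∀ x ∈ γ, x = (n : ℤ) + 1 ∨ x = -((n : ℤ) + 1) ∨ (-(n : ℤ) ≤ x ∧ x ≤ n) := by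
    intro γ hγ x hx
    have := h.bd γ hγ x hx
    push_cast at this
    omega
  have neTop : ∀ γ ∈ T, (n : ℤ) + 1 ∈ γ → ∃ x, x ∈ cut n γ := by
    intro γ hγ hx
    by_contra hne
    push Not at hne
    have n1 : -((n : ℤ) + 1) ∉ γ := by
      intro hx'
      exact hne 0 (mem_cut.2 ⟨h.ze γ hγ _ hx hx', by omega, by omega⟩)
    apply ht
    convert hγ
    ext x
    rw [Finset.mem_singleton]
    constructor
    · rintro rfl; exact hx
    · intro hxγ
      rcases bd γ hγ x hxγ with e | e | e
      · exact e
      · exact absurd (e ▸ hxγ) n1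
      · exact absurd (mem_cut.2 ⟨hxγ, e⟩) (hne x)
  have ne : ∀ γ ∈ T, ∃ x, x ∈ cut n γ := by
    intro γ hγ
    obtain ⟨x, hx⟩ := h.ne γ hγ
    rcases bd γ hγ x hx with rfl | rfl | e
    · exact neTop γ hγ hx
    · obtain ⟨y, hy⟩ := neTop (negBlock γ) (h.ng γ hγ) (mem_negBlock.2 hx)
      rw [cut_negBlock, mem_negBlock] at hy
      exact ⟨_, hy⟩
    · exact ⟨x, mem_cut.2 ⟨hx, e⟩⟩
  have inj : ∀ γ ∈ T, ∀ δ ∈ T, cut n γ = cut n δ → γ = δ := by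
    intro γ hγ δ hδ e
    obtain ⟨x, hx⟩ := ne γ hγ
    have hx' := hx
    rw [e] at hx'
    exact h.un γ hγ δ hδ x (mem_cut.1 hx).1 (mem_cut.1 hx').1
  refine ⟨T.image (cut n), ⟨?_, ?_, ?_, ?_, ?_, ?_⟩, cut n B, Finset.mem_image_of_mem _ hB, ?_⟩
  · intro γ hγ
    replace hγ := Finset.mem_image.1 hγ; obtain ⟨γ, hγ, rfl⟩ := hγ
    exact ne γ hγ
  · intro γ hγ x hx
    replace hγ := Finset.mem_image.1 hγ; obtain ⟨γ, hγ, rfl⟩ := hγ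
    exact (mem_cut.1 hx).2
  · intro x h1 h2
    obtain ⟨γ, hγ, hx⟩ := h.ex x (by push_cast; omega) (by push_cast; omega)
    exact ⟨_, Finset.mem_image_of_mem _ hγ, mem_cut.2 ⟨hx, h1, h2⟩⟩
  · intro γ hγ δ hδ x hx hx'
    replace hγ := Finset.mem_image.1 hγ; obtain ⟨γ, hγ, rfl⟩ := hγ
    replace hδ := Finset.mem_image.1 hδ; obtain ⟨δ, hδ, rfl⟩ := hδ
    rw [h.un γ hγ δ hδ x (mem_cut.1 hx).1 (mem_cut.1 hx').1]
  · intro γ hγ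
    replace hγ := Finset.mem_image.1 hγ; obtain ⟨γ, hγ, rfl⟩ := hγ
    rw [← cut_negBlock]
    exact Finset.mem_image_of_mem _ (h.ng γ hγ)
  · intro γ hγ x hx hx'
    replace hγ := Finset.mem_image.1 hγ; obtain ⟨γ, hγ, rfl⟩ := hγ
    exact mem_cut.2 ⟨h.ze γ hγ x (mem_cut.1 hx).1 (mem_cut.1 hx').1, by omega, by omega⟩
  · have key : ∀ γ ∈ T, grow n (cut n B) (cut n γ) = γ := by
      intro γ hγ
      ext x
      rw [mem_grow, mem_cut, ← cut_negBlock]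
      constructor
      · rintro (h1 | ⟨rfl, h1⟩ | ⟨rfl, h1⟩)
        · exact h1.1
        · rw [inj γ hγ B hB h1]; exact hBt
        · rw [inj γ hγ _ (h.ng B hB) h1, mem_negBlock, neg_neg]; exact hBt
      · intro hx
        rcases bd γ hγ x hx with e | e | e
        · subst e
          exact Or.inr (Or.inl ⟨rfl, by rw [h.un γ hγ B hB _ hx hBt]⟩)
        · subst e
          refine Or.inr (Or.inr ⟨rfl, ?_⟩)
          rw [h.un γ hγ _ (h.ng B hB) _ hx (by rw [mem_negBlock, neg_neg]; exact hBt)]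
        · exact Or.inl ⟨hx, e⟩
    ext γ
    rw [Finset.mem_image]
    constructor
    · rintro ⟨δ, hδ, rfl⟩
      replace hδ := Finset.mem_image.1 hδ; obtain ⟨δ, hδ, rfl⟩ := hδ
      rw [key δ hδ]
      exact hδ
    · intro hγ
      exact ⟨_, Finset.mem_image_of_mem _ hγ, key γ hγ⟩

theorem card_not_single (n k : ℕ) :
    ((goodFam (n + 1) k).filter (fun T => ¬ ({(n : ℤ) + 1} : Finset ℤ) ∈ T)).card
      = (2 * k + 1) * (goodFam n k).card := by
  have hs : ((goodFam n k).sigma (fun S => S)).card = (2 * k + 1) * (goodFam n k).card := by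
    rw [Finset.card_sigma, Finset.sum_congr rfl (fun S hS => (mem_goodFam.1 hS).2),
      Finset.sum_const, smul_eq_mul, mul_comm]
  rw [← hs]
  symm
  refine Finset.card_bij (fun p _ => p.1.image (grow n p.2)) ?_ ?_ ?_
  · rintro ⟨S, β⟩ hp
    obtain ⟨hS, hβ⟩ := Finset.mem_sigma.1 hp
    obtain ⟨hg, hc⟩ := mem_goodFam.1 hS
    rw [Finset.mem_filter, mem_goodFam]
    refine ⟨⟨hg.grow hβ, (hg.card_grow β).trans hc⟩, ?_⟩
    intro hm
    obtain ⟨γ, hγ, e⟩ := Finset.mem_image.1 hm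
    obtain ⟨x, hx⟩ := hg.ne γ hγ
    have : x ∈ grow n β γ := mem_grow.2 (Or.inl hx)
    have e' : grow n β γ = {(n : ℤ) + 1} := e
    rw [e', Finset.mem_singleton] at this
    subst this
    exact hg.top_notMem hγ hx
  · rintro ⟨S, β⟩ hp ⟨S', β'⟩ hp' e
    obtain ⟨hS, hβ⟩ := Finset.mem_sigma.1 hp
    obtain ⟨hS', hβ'⟩ := Finset.mem_sigma.1 hp'
    obtain ⟨hg, -⟩ := mem_goodFam.1 hS
    obtain ⟨hg', -⟩ := mem_goodFam.1 hS'
    simp only at hS hβ hS' hβ' hg hg' e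
    have e1 : S = S' := by
      rw [← hg.image_cut_grow β, e, hg'.image_cut_grow]
    subst e1
    have hm : grow n β β ∈ S.image (grow n β') := e ▸ Finset.mem_image_of_mem _ hβ
    obtain ⟨γ, hγ, e2⟩ := Finset.mem_image.1 hm
    have e3 : γ = β := by
      rw [← hg.cut_grow β' hγ, e2, hg.cut_grow β hβ]
    have : (n : ℤ) + 1 ∈ grow n β' γ := by
      rw [e2, hg.top_mem_grow β hβ]
    rw [hg.top_mem_grow β' hγ] at this
    rw [← e3, this]
  · intro T hT
    rw [Finset.mem_filter, mem_goodFam] at hT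
    obtain ⟨⟨hg, hc⟩, ht⟩ := hT
    obtain ⟨S, gS, β, hβ, rfl⟩ := exists_grow hg ht
    refine ⟨⟨S, β⟩, Finset.mem_sigma.2 ⟨mem_goodFam.2 ⟨gS, ?_⟩, hβ⟩, rfl⟩
    rw [← hc, gS.card_grow]

/-- The numbers `T(n,k)` of `Bₙ`-type set partitions with exactly `k` block pairs satisfy
`T(n,k) = (2k+1)·T(n−1,k) + T(n−1,k−1)` for `n, k ≥ 1`, and `T(n,0) = 1` for all `n`. -/
theorem Tb_recurrence :
    (∀ n k : ℕ, 1 ≤ n → 1 ≤ k →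
      Tb n k = (2 * k + 1) * Tb (n - 1) k + Tb (n - 1) (k - 1)) ∧
    (∀ n : ℕ, Tb n 0 = 1) := by
  constructor
  · intro n k hn hk
    obtain ⟨n, rfl⟩ := Nat.exists_eq_add_of_le' hn
    obtain ⟨k, rfl⟩ := Nat.exists_eq_add_of_le' hk
    simp only [Nat.add_sub_cancel, Tb_eq]
    have key := Finset.card_filter_add_card_filter_not (s := goodFam (n + 1) (k + 1))
      (fun T => ({(n : ℤ) + 1} : Finset ℤ) ∈ T)
    rw [card_single] at key
    rw [← key, ← card_not_single, add_comm]
  · intro n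
    rw [Tb_eq, goodFam_zero]
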